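/- Let l ≥ 1 and q ≥ 2 be integers and set n = q(2l+1). Define s = 2·sin(πl/(2l+1))·cos(π/n) and t = 2·sin(πl/(2l+1)). For each real r > 0, the number of distinct inscribed equilateral (2l+1)-pointed stars of side length r in P_n, where two stars are identified when their point sets {u_0, …, u_{2l}} ⊆ P_n are equal, is: q if r = s or r = t; 2q if s < r < t; and 0 if r < s or r > t. -/

import Mathlib

noncomputable section

/-- The primitive `n`-th root of unity `ω = exp(2πi/n)`. -/
def nroot (n : ℕ) : ℂ := Complex.exp (2 * Real.pi * Complex.I / n)

/-- The boundary of the regular `n`-gon inscribed in the unit circle, as a subset of `ℂ`: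
the union of the closed segments from `ω^j` to `ω^(j+1)` for `j = 0, …, n-1`. -/
def polygon (n : ℕ) : Set ℂ :=
  ⋃ j ∈ Finset.range n, segment ℝ ((nroot n) ^ j) ((nroot n) ^ (j + 1))

/-- The critical scale `r_n`: `2 cos(π/n)` for even `n`,
and `1 + cos(2π/n)/cos(π/n)` for odd `n`. -/
def rpoly (n : ℕ) : ℝ :=
  if Even n then 2 * Real.cos (Real.pi / n)
  else 1 + Real.cos (2 * Real.pi / n) / Real.cos (Real.pi / n)

/-- Arc-length parametrization of the polygon `P_n` by the parameter `t` (normalized so that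
`t ∈ [0,1)` traverses the polygon once counterclockwise, with vertices at `t = j/n`). -/
def polyParam (n : ℕ) (t : ℝ) : ℂ :=
  ((1 - Int.fract (n * t) : ℝ) : ℂ) * (nroot n) ^ (⌊(n : ℝ) * t⌋) +
    ((Int.fract (n * t) : ℝ) : ℂ) * (nroot n) ^ (⌊(n : ℝ) * t⌋ + 1)

/-- The parameter value in `[0,1)` of a point `x ∈ P_n`. -/
def polyArg (n : ℕ) (x : ℂ) : ℝ :=
  sInf {t : ℝ | t ∈ Set.Ico (0 : ℝ) 1 ∧ polyParam n t = x}

/-- The normalized counterclockwise arc distance from `x` to `y` along `P_n`: the length of the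
counterclockwise path along `P_n` from `x` to `y` divided by the total perimeter of `P_n`. -/
def polyDist (n : ℕ) (x y : ℂ) : ℝ := Int.fract (polyArg n y - polyArg n x)

/-- `z` is strictly counterclockwise-between `x` and `y` on `P_n`. -/
def SCCWBtw (n : ℕ) (x z y : ℂ) : Prop :=
  0 < polyDist n x z ∧ polyDist n x z < polyDist n x y

/-- An inscribed equilateral `(2l+1)`-pointed star of side length `r` based at `p ∈ P_n`:
a tuple `(u 0, …, u (2l+1))` of points of `P_n` with `u 0 = u (2l+1) = p`, where consecutive
points are at Euclidean distance `r`, every point of `P_n` strictly counterclockwise-between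
`u i` and `u (i+1)` is at distance `< r` from `u i`, and the total winding number is `l`. -/
def IsStar (n l : ℕ) (r : ℝ) (p : ℂ) (u : ℕ → ℂ) : Prop :=
  u 0 = p ∧ u (2 * l + 1) = p ∧
  (∀ i ≤ 2 * l + 1, u i ∈ polygon n) ∧
  (∀ i ≤ 2 * l, dist (u i) (u (i + 1)) = r) ∧
  (∀ i ≤ 2 * l, ∀ z ∈ polygon n, SCCWBtw n (u i) z (u (i + 1)) → dist (u i) z < r) ∧
  (∑ i ∈ Finset.range (2 * l + 1), polyDist n (u i) (u (i + 1))) = (l : ℝ)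

/-- `x` is a vertex of `P_n`. -/
def IsVertex (n : ℕ) (x : ℂ) : Prop := ∃ j < n, x = (nroot n) ^ j

/-- `x` is the midpoint of an edge of `P_n`. -/
def IsMidpoint (n : ℕ) (x : ℂ) : Prop :=
  ∃ j < n, x = ((nroot n) ^ j + (nroot n) ^ (j + 1)) / 2

end

/-- The collection of point sets `{u 0, …, u (2l)}` of inscribed equilateral
`(2l+1)`-pointed stars of side length `r` in `P_n` (two stars are identified when their point
sets agree). -/
noncomputable def starSets (n l : ℕ) (r : ℝ) : Set (Set ℂ) :=
  {A : Set ℂ | ∃ p ∈ polygon n, ∃ u : ℕ → ℂ, IsStar n l r p u ∧ A = u '' Set.Iic (2 * l)}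

/-- The parametrization of `P_n` by edge lengths: the vertex `ω ^ k` has parameter `k`. -/
noncomputable def edgePoint (n : ℕ) (x : ℝ) : ℂ :=
  nroot n ^ ⌊x⌋ * (1 + ((Int.fract x : ℝ) : ℂ) * (nroot n - 1))

theorem nroot_zpow (n : ℕ) (k : ℤ) :
    nroot n ^ k = ⟨Real.cos (k * (2 * Real.pi / n)), Real.sin (k * (2 * Real.pi / n))⟩ := by
  have h : nroot n ^ k = Complex.exp (((k * (2 * Real.pi / n) : ℝ) : ℂ) * Complex.I) := by
    rw [nroot, ← Complex.exp_int_mul]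
    congr 1
    push_cast
    ring
  rw [h]
  apply Complex.ext
  · rw [Complex.exp_ofReal_mul_I_re]
  · rw [Complex.exp_ofReal_mul_I_im]

theorem nroot_eq (n : ℕ) :
    nroot n = ⟨Real.cos (2 * Real.pi / n), Real.sin (2 * Real.pi / n)⟩ := by
  simpa using nroot_zpow n 1

theorem norm_nroot (n : ℕ) : ‖nroot n‖ = 1 := by
  have h : nroot n = Complex.exp (((2 * Real.pi / n : ℝ) : ℂ) * Complex.I) := by
    rw [nroot]
    congr 1
    push_cast
    ring
  rw [h, Complex.norm_exp_ofReal_mul_I]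

theorem nroot_ne_zero (n : ℕ) : nroot n ≠ 0 := Complex.exp_ne_zero _

theorem nroot_pow_self {n : ℕ} (hn : n ≠ 0) : nroot n ^ n = 1 := by
  have hn' : (n : ℂ) ≠ 0 := by exact_mod_cast hn
  rw [nroot, ← Complex.exp_nat_mul, mul_div_cancel₀ _ hn', Complex.exp_two_pi_mul_I]

theorem nroot_zpow_mul {n : ℕ} (hn : n ≠ 0) (k : ℤ) : nroot n ^ ((n : ℤ) * k) = 1 := by
  rw [zpow_mul, zpow_natCast, nroot_pow_self hn, one_zpow]

theorem edgePoint_int_add (n : ℕ) (k : ℤ) {b : ℝ} (hb0 : 0 ≤ b) (hb1 : b ≤ 1) :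
    edgePoint n (k + b) = nroot n ^ k * (1 + (b : ℂ) * (nroot n - 1)) := by
  rcases hb1.eq_or_lt with rfl | hb
  · have h1 : ((k : ℝ) + 1) = ((k + 1 : ℤ) : ℝ) := by push_cast; ring
    rw [edgePoint, h1, Int.floor_intCast, Int.fract_intCast, zpow_add_one₀ (nroot_ne_zero n)]
    push_cast
    ring
  · rw [edgePoint, Int.floor_intCast_add, Int.fract_intCast_add, Int.fract_eq_self.2 ⟨hb0, hb⟩,
      Int.floor_eq_zero_iff.2 ⟨hb0, hb⟩, add_zero]

theorem edgePoint_add_int (n : ℕ) (x : ℝ) (k : ℤ) :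
    edgePoint n (x + k) = nroot n ^ k * edgePoint n x := by
  rw [edgePoint, edgePoint, Int.floor_add_intCast, Int.fract_add_intCast,
    zpow_add₀ (nroot_ne_zero n)]
  ring

theorem edgePoint_intCast (n : ℕ) (k : ℤ) : edgePoint n k = nroot n ^ k := by
  simp [edgePoint]

theorem edgePoint_add_mul_int {n : ℕ} (hn : n ≠ 0) (x : ℝ) (k : ℤ) :
    edgePoint n (x + n * k) = edgePoint n x := by
  have h : ((n : ℝ) * k) = ((n * k : ℤ) : ℝ) := by push_cast; ring
  rw [h, edgePoint_add_int, nroot_zpow_mul hn, one_mul]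

theorem polyParam_eq_edgePoint (n : ℕ) (t : ℝ) : polyParam n t = edgePoint n (n * t) := by
  rw [polyParam, edgePoint, zpow_add_one₀ (nroot_ne_zero n)]
  push_cast
  ring

theorem norm_nroot_zpow_mul (n : ℕ) (k : ℤ) (z : ℂ) : ‖nroot n ^ k * z‖ = ‖z‖ := by
  rw [norm_mul, norm_zpow, norm_nroot, one_zpow, one_mul]

theorem cos_two_pi_div (n : ℕ) :
    Real.cos (2 * Real.pi / n) = 1 - 2 * Real.sin (Real.pi / n) ^ 2 := by
  rw [mul_div_assoc, Real.cos_two_mul, Real.cos_sq']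
  ring

theorem norm_one_add_mul_sq (n : ℕ) (b : ℝ) :
    ‖1 + (b : ℂ) * (nroot n - 1)‖ ^ 2 = 1 - 4 * (b * (1 - b)) * Real.sin (Real.pi / n) ^ 2 := by
  have h := Real.sin_sq_add_cos_sq (2 * Real.pi / n)
  have h2 := cos_two_pi_div n
  rw [← Complex.normSq_eq_norm_sq, Complex.normSq_apply, nroot_eq]
  simp
  linear_combination b ^ 2 * h + (2 * b - 2 * b ^ 2) * h2

theorem norm_edgePoint_sq (n : ℕ) (x : ℝ) :
    ‖edgePoint n x‖ ^ 2 =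
      1 - 4 * (Int.fract x * (1 - Int.fract x)) * Real.sin (Real.pi / n) ^ 2 := by
  rw [edgePoint, norm_nroot_zpow_mul, norm_one_add_mul_sq]

theorem range_edgePoint {n : ℕ} (hn : n ≠ 0) : Set.range (edgePoint n) = polygon n := by
  ext z
  simp only [polygon, Set.mem_iUnion, Finset.mem_range, Set.mem_range, exists_prop]
  constructor
  · rintro ⟨x, rfl⟩
    have hn' : (n : ℤ) ≠ 0 := by exact_mod_cast hn
    have hm0 := Int.emod_nonneg ⌊x⌋ hn'
    have hm1 := Int.emod_lt_of_pos ⌊x⌋ (b := (n : ℤ)) (by omega)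
    obtain ⟨j, hj⟩ := Int.eq_ofNat_of_zero_le hm0
    refine ⟨j, by omega, 1 - Int.fract x, Int.fract x, ?_, Int.fract_nonneg x, by ring, ?_⟩
    · linarith [Int.fract_lt_one x]
    · have h : nroot n ^ ⌊x⌋ = nroot n ^ j := by
        conv_lhs => rw [← Int.mul_ediv_add_emod ⌊x⌋ n]
        rw [zpow_add₀ (nroot_ne_zero n), nroot_zpow_mul hn, one_mul, hj]
        simp
      rw [edgePoint, h, pow_succ]
      simp only [Complex.real_smul]
      push_cast
      ring
  · rintro ⟨j, -, a, b, ha, hb, hab, rfl⟩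
    refine ⟨((j : ℤ) : ℝ) + b, ?_⟩
    rw [edgePoint_int_add n j hb (by linarith), zpow_natCast, pow_succ]
    obtain rfl : a = 1 - b := by linarith
    simp only [Complex.real_smul]
    push_cast
    ring

theorem exists_arg_one_add_mul {n : ℕ} (hn : 3 ≤ n) {b : ℝ} (hb0 : 0 ≤ b) (hb1 : b < 1) :
    ∃ ρ θ : ℝ, 0 < ρ ∧ 0 ≤ θ ∧ θ < 2 * Real.pi / n ∧
      1 + (b : ℂ) * (nroot n - 1) = ρ * Complex.exp (θ * Complex.I) := by
  have hn' : (3 : ℝ) ≤ n := by exact_mod_cast hn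
  have hpi := Real.pi_pos
  have hα0 : 0 < 2 * Real.pi / n := by positivity
  have hα1 : 2 * Real.pi / n < Real.pi := by
    rw [div_lt_iff₀ (by linarith)]
    nlinarith
  have hs := Real.sin_pos_of_pos_of_lt_pi hα0 hα1
  set α := 2 * Real.pi / n with hα
  set w := 1 + (b : ℂ) * (nroot n - 1) with hw
  have him : w.im = b * Real.sin α := by simp [hw, nroot_eq, hα]
  have hre : w.re = 1 + b * (Real.cos α - 1) := by simp [hw, nroot_eq, hα]
  have hneg : w.im * Real.cos α - w.re * Real.sin α < 0 := by
    rw [him, hre]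
    nlinarith
  have hw0 : w ≠ 0 := by
    intro h
    rw [h] at hneg
    simp at hneg
  have hpos : 0 < ‖w‖ := norm_pos_iff.2 hw0
  have harg0 : 0 ≤ w.arg := Complex.arg_nonneg_iff.2 (by rw [him]; positivity)
  refine ⟨‖w‖, w.arg, hpos, harg0, ?_, (Complex.norm_mul_exp_arg_mul_I w).symm⟩
  by_contra! hle
  have h1 : 0 ≤ Real.sin (w.arg - α) :=
    Real.sin_nonneg_of_nonneg_of_le_pi (by linarith) (by linarith [Complex.arg_le_pi w])
  rw [Real.sin_sub, Complex.sin_arg, Complex.cos_arg hw0] at h1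
  have h2 : w.im / ‖w‖ * Real.cos α - w.re / ‖w‖ * Real.sin α =
    (w.im * Real.cos α - w.re * Real.sin α) / ‖w‖ := by ring
  rw [h2] at h1
  exact absurd (div_neg_of_neg_of_pos hneg hpos) (not_lt.2 h1)

theorem edgePoint_eq_edgePoint {n : ℕ} (hn : 3 ≤ n) {x y : ℝ}
    (h : edgePoint n x = edgePoint n y) : ∃ k : ℤ, x = y + n * k := by
  obtain ⟨ρ, θ, hρ, hθ0, hθ1, hx⟩ :=
    exists_arg_one_add_mul hn (Int.fract_nonneg x) (Int.fract_lt_one x)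
  obtain ⟨σ, φ, hσ, hφ0, hφ1, hy⟩ :=
    exists_arg_one_add_mul hn (Int.fract_nonneg y) (Int.fract_lt_one y)
  have hn' : (3 : ℝ) ≤ n := by exact_mod_cast hn
  have hpi := Real.pi_pos
  have hω (k : ℤ) : nroot n ^ k = Complex.exp (((k * (2 * Real.pi / n) : ℝ) : ℂ) * Complex.I) := by
    rw [nroot, ← Complex.exp_int_mul]
    congr 1
    push_cast
    ring
  have hnorm : ρ = σ := by
    have := congrArg norm h
    rw [edgePoint, edgePoint, norm_nroot_zpow_mul, norm_nroot_zpow_mul, hx, hy, norm_mul, norm_mul,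
      Complex.norm_exp_ofReal_mul_I, Complex.norm_exp_ofReal_mul_I] at this
    simpa [abs_of_pos hρ, abs_of_pos hσ] using this
  have hρ0 : (ρ : ℂ) ≠ 0 := by exact_mod_cast hρ.ne'
  have hexp : Complex.exp (((⌊x⌋ * (2 * Real.pi / n) + θ : ℝ) : ℂ) * Complex.I) =
      Complex.exp (((⌊y⌋ * (2 * Real.pi / n) + φ : ℝ) : ℂ) * Complex.I) := by
    have h' := h
    rw [edgePoint, edgePoint, hx, hy, hω, hω, ← hnorm] at h'
    apply mul_left_cancel₀ hρ0
    calc _ = Complex.exp (((⌊x⌋ * (2 * Real.pi / n) : ℝ) : ℂ) * Complex.I) *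
        (ρ * Complex.exp (θ * Complex.I)) := by
          rw [Complex.ofReal_add, add_mul, Complex.exp_add]; ring
      _ = _ := h'
      _ = _ := by rw [Complex.ofReal_add, add_mul, Complex.exp_add]; ring
  obtain ⟨N, hN⟩ := Complex.exp_eq_exp_iff_exists_int.1 hexp
  have hN' : ⌊x⌋ * (2 * Real.pi / n) + θ = ⌊y⌋ * (2 * Real.pi / n) + φ + N * (2 * Real.pi) := by
    have : (((⌊x⌋ * (2 * Real.pi / n) + θ : ℝ) : ℂ)) * Complex.I =
      ((⌊y⌋ * (2 * Real.pi / n) + φ + N * (2 * Real.pi) : ℝ) : ℂ) * Complex.I := by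
      rw [hN]; push_cast; ring
    exact_mod_cast mul_right_cancel₀ Complex.I_ne_zero this
  have hfloor : ⌊x⌋ = ⌊y⌋ + n * N := by
    have hα : 0 < 2 * Real.pi / n := by positivity
    have h1 : ((⌊x⌋ - ⌊y⌋ - n * N : ℤ) : ℝ) * (2 * Real.pi / n) = φ - θ := by
      push_cast
      have : (n : ℝ) * (2 * Real.pi / n) = 2 * Real.pi := by field_simp
      linear_combination hN' - N * this
    have h2 : ((⌊x⌋ - ⌊y⌋ - n * N : ℤ) : ℝ) < 1 := by
      by_contra! hc
      nlinarith
    have h3 : (-1 : ℝ) < ((⌊x⌋ - ⌊y⌋ - n * N : ℤ) : ℝ) := by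
      by_contra! hc
      nlinarith
    have h2' : ⌊x⌋ - ⌊y⌋ - n * N < 1 := by exact_mod_cast h2
    have h3' : -1 < ⌊x⌋ - ⌊y⌋ - n * N := by exact_mod_cast h3
    linarith [show ⌊x⌋ - ⌊y⌋ - n * N = 0 by omega]
  refine ⟨N, ?_⟩
  have hω1 : nroot n - 1 ≠ 0 := by
    intro h0
    have h1 := congrArg Complex.im h0
    rw [nroot_eq] at h1
    have hα1 : 2 * Real.pi / n < Real.pi := by
      rw [div_lt_iff₀ (by linarith)]
      nlinarith
    have := Real.sin_pos_of_pos_of_lt_pi (by positivity) hα1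
    simp at h1
    linarith
  have hfract : Int.fract x = Int.fract y := by
    rw [edgePoint, edgePoint, hfloor, zpow_add₀ (nroot_ne_zero n),
      nroot_zpow_mul (by omega), mul_one] at h
    have h1 := mul_left_cancel₀ (zpow_ne_zero _ (nroot_ne_zero n)) h
    have h2 := mul_right_cancel₀ hω1 (add_left_cancel h1)
    exact_mod_cast h2
  have hfloor' : (⌊x⌋ : ℝ) = ⌊y⌋ + n * N := by exact_mod_cast hfloor
  linarith [Int.floor_add_fract x, Int.floor_add_fract y]

theorem polyArg_edgePoint {n : ℕ} (hn : 3 ≤ n) (x : ℝ) :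
    polyArg n (edgePoint n x) = Int.fract (x / n) := by
  have hn0 : (n : ℝ) ≠ 0 := by
    have : n ≠ 0 := by omega
    exact_mod_cast this
  have hset : {t : ℝ | t ∈ Set.Ico (0 : ℝ) 1 ∧ polyParam n t = edgePoint n x} =
      {Int.fract (x / n)} := by
    ext t
    simp only [Set.mem_ofPred_eq, Set.mem_singleton_iff, polyParam_eq_edgePoint]
    constructor
    · rintro ⟨ht, h⟩
      obtain ⟨k, hk⟩ := edgePoint_eq_edgePoint hn h
      have : t = x / n + k := by
        field_simp
        linarith
      rw [← Int.fract_eq_self.2 ht, this, Int.fract_add_intCast]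
    · rintro rfl
      refine ⟨⟨Int.fract_nonneg _, Int.fract_lt_one _⟩, ?_⟩
      have : (n : ℝ) * Int.fract (x / n) = x + n * ((-⌊x / n⌋ : ℤ) : ℝ) := by
        rw [Int.fract]
        push_cast
        field_simp
        ring
      rw [this, edgePoint_add_mul_int (by omega)]
  rw [polyArg, hset, csInf_singleton]

theorem polyDist_edgePoint {n : ℕ} (hn : 3 ≤ n) (x y : ℝ) :
    polyDist n (edgePoint n x) (edgePoint n y) = Int.fract ((y - x) / n) := by
  rw [polyDist, polyArg_edgePoint hn, polyArg_edgePoint hn, Int.fract_eq_fract]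
  refine ⟨⌊x / n⌋ - ⌊y / n⌋, ?_⟩
  rw [Int.fract, Int.fract]
  push_cast
  ring

theorem polyDist_edgePoint_add {n : ℕ} (hn : 3 ≤ n) (x : ℝ) {d : ℝ} (hd0 : 0 ≤ d) (hdn : d < n) :
    polyDist n (edgePoint n x) (edgePoint n (x + d)) = d / n := by
  have hn0 : (0 : ℝ) < n := by
    have : 0 < n := by omega
    exact_mod_cast this
  rw [polyDist_edgePoint hn, add_sub_cancel_left, Int.fract_eq_self]
  exact ⟨by positivity, (div_lt_one hn0).2 hdn⟩

theorem edgePoint_add_polyDist {n : ℕ} (hn : 3 ≤ n) (x : ℝ) {z : ℂ} (hz : z ∈ polygon n) :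
    edgePoint n (x + n * polyDist n (edgePoint n x) z) = z := by
  rw [← range_edgePoint (by omega)] at hz
  obtain ⟨y, rfl⟩ := hz
  have hn0 : (n : ℝ) ≠ 0 := by
    have : n ≠ 0 := by omega
    exact_mod_cast this
  have : x + n * Int.fract ((y - x) / n) = y + n * ((-⌊(y - x) / n⌋ : ℤ) : ℝ) := by
    rw [Int.fract]
    push_cast
    field_simp
    ring
  rw [polyDist_edgePoint hn, this, edgePoint_add_mul_int (by omega)]

theorem edgePoint_of_mem_Icc (n : ℕ) {b : ℝ} (hb0 : 0 ≤ b) (hb1 : b ≤ 1) :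
    edgePoint n b = 1 + (b : ℂ) * (nroot n - 1) := by
  simpa using edgePoint_int_add n 0 hb0 hb1

theorem dist_edgePoint_add_int (n : ℕ) (x y : ℝ) (k : ℤ) :
    dist (edgePoint n (x + k)) (edgePoint n (y + k)) = dist (edgePoint n x) (edgePoint n y) := by
  rw [edgePoint_add_int, edgePoint_add_int, dist_eq_norm, ← mul_sub, norm_nroot_zpow_mul,
    dist_eq_norm]

theorem cos_chord_nonneg {A B : ℝ} (hA : 0 ≤ A) (hB : 0 ≤ B) (hAB : A + B ≤ Real.pi / 2) :
    0 ≤ Real.cos (2 * B) - 1 - Real.cos (2 * A + 2 * B) + Real.cos (2 * A) := by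
  have h : Real.cos (2 * B) - 1 - Real.cos (2 * A + 2 * B) + Real.cos (2 * A) =
      4 * Real.sin A * Real.sin B * Real.cos (A + B) := by
    have h1 := Real.sin_sq_add_cos_sq A
    have h2 := Real.sin_sq_add_cos_sq B
    rw [Real.cos_add (2 * A), Real.cos_add A, Real.cos_two_mul, Real.cos_two_mul, Real.sin_two_mul,
      Real.sin_two_mul]
    grind
  have hpi := Real.pi_pos
  rw [h]
  have h1 := Real.sin_nonneg_of_nonneg_of_le_pi hA (by linarith)
  have h2 := Real.sin_nonneg_of_nonneg_of_le_pi hB (by linarith)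
  have h3 := Real.cos_nonneg_of_neg_pi_div_two_le_of_le (x := A + B) (by linarith) hAB
  positivity

theorem cos_chord_sub_nonneg {A B : ℝ} (hA : 0 ≤ A) (hB : 0 ≤ B) (hAB : A + B ≤ Real.pi / 2) :
    0 ≤ Real.cos (2 * A - 2 * B) - Real.cos (2 * A) - Real.cos (2 * B) + 1 := by
  have h : Real.cos (2 * A - 2 * B) - Real.cos (2 * A) - Real.cos (2 * B) + 1 =
      4 * Real.sin A * Real.sin B * Real.cos (A - B) := by
    have h1 := Real.sin_sq_add_cos_sq A
    have h2 := Real.sin_sq_add_cos_sq B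
    rw [Real.cos_sub (2 * A), Real.cos_sub A, Real.cos_two_mul, Real.cos_two_mul, Real.sin_two_mul,
      Real.sin_two_mul]
    grind
  have hpi := Real.pi_pos
  rw [h]
  have h1 := Real.sin_nonneg_of_nonneg_of_le_pi hA (by linarith)
  have h2 := Real.sin_nonneg_of_nonneg_of_le_pi hB (by linarith)
  have h3 := Real.cos_nonneg_of_neg_pi_div_two_le_of_le (x := A - B) (by linarith) (by linarith)
  positivity

theorem nroot_re_lt_one {n : ℕ} (hn : 3 ≤ n) : (nroot n).re < 1 := by
  have hn' : (3 : ℝ) ≤ n := by exact_mod_cast hn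
  have hpi := Real.pi_pos
  have h0 : 0 < 2 * Real.pi / n := by positivity
  have h1 : 2 * Real.pi / n ≤ Real.pi := by
    rw [div_le_iff₀ (by linarith)]
    nlinarith
  have := Real.cos_lt_cos_of_nonneg_of_le_pi le_rfl h1 h0
  rw [nroot_eq]
  simpa using this

theorem nroot_normSq (n : ℕ) : (nroot n).re ^ 2 + (nroot n).im ^ 2 = 1 := by
  rw [nroot_eq]
  exact Real.cos_sq_add_sin_sq _

theorem nroot_pow_normSq (n k : ℕ) : (nroot n ^ k).re ^ 2 + (nroot n ^ k).im ^ 2 = 1 := by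
  rw [← zpow_natCast (nroot n), nroot_zpow]
  exact Real.cos_sq_add_sin_sq _

/-- The three products of chords of the regular `n`-gon that control the growth of distances
along the polygon up to the `k`-th edge, when `k + 1` edges cover at most half of it. -/
theorem nroot_chord_nonneg {n k : ℕ} (hk : 1 ≤ k) (hkn : 2 * (k + 1) ≤ n) :
    0 ≤ (nroot n).re - 1 - (nroot n ^ k * nroot n).re + (nroot n ^ k).re ∧
    0 ≤ (nroot n ^ k * starRingEnd ℂ (nroot n)).re - (nroot n ^ k).re - (nroot n).re + 1 ∧
    0 ≤ (nroot n).re - 1 - (nroot n ^ k).re + (nroot n ^ k * starRingEnd ℂ (nroot n)).re := by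
  have hk' : (1 : ℝ) ≤ k := by exact_mod_cast hk
  have hkn' : (2 : ℝ) * (k + 1) ≤ n := by exact_mod_cast hkn
  have hpi := Real.pi_pos
  have hnpos : (0 : ℝ) < n := by linarith
  have hB : 0 ≤ Real.pi / n := by positivity
  have hAB : k * (Real.pi / n) + Real.pi / n ≤ Real.pi / 2 := by
    have : k * (Real.pi / n) + Real.pi / n = (k + 1) * Real.pi / n := by ring
    rw [this, div_le_div_iff₀ hnpos two_pos]
    nlinarith
  have e : ((k : ℤ) : ℝ) = k := by simp
  have e1 : 2 * (Real.pi / n) = 2 * Real.pi / n := by ring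
  have e2 : 2 * (k * (Real.pi / n)) = k * (2 * Real.pi / n) := by ring
  have e3 : 2 * ((k - 1) * (Real.pi / n)) = k * (2 * Real.pi / n) - 2 * Real.pi / n := by ring
  have h1 := cos_chord_nonneg (by positivity) hB hAB
  have h2 := cos_chord_sub_nonneg (by positivity) hB hAB
  have h3 := cos_chord_nonneg (A := (k - 1) * (Real.pi / n))
    (mul_nonneg (by linarith) hB) hB (by nlinarith)
  rw [e1, e2] at h1 h2
  rw [e1, e3] at h3
  rw [Real.cos_add] at h1
  rw [Real.cos_sub] at h2
  rw [sub_add_cancel, Real.cos_sub] at h3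
  rw [← zpow_natCast, nroot_zpow, nroot_eq, e]
  simp
  exact ⟨by linarith, by linarith, by linarith⟩

/-- From a point of the first edge, the vertices `ω ^ 1, ω ^ 2, …` up to half of the polygon get
farther and farther. -/
theorem norm_sub_nroot_pow_lt {n i j : ℕ} (hi : 1 ≤ i) (hij : i < j) (hjn : 2 * j ≤ n) {b : ℝ}
    (hb0 : 0 ≤ b) (hb1 : b ≤ 1) :
    ‖1 + (b : ℂ) * (nroot n - 1) - nroot n ^ i‖ < ‖1 + (b : ℂ) * (nroot n - 1) - nroot n ^ j‖ := by
  have hi' : (1 : ℝ) ≤ i := by exact_mod_cast hi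
  have hij' : (i : ℝ) < j := by exact_mod_cast hij
  have hjn' : (2 : ℝ) * j ≤ n := by exact_mod_cast hjn
  have hpi := Real.pi_pos
  have hnpos : (0 : ℝ) < n := by linarith
  have hα : 0 < 2 * Real.pi / n := by positivity
  have hj : j * (2 * Real.pi / n) ≤ Real.pi := by
    rw [mul_div_assoc', div_le_iff₀ hnpos]
    nlinarith
  have h1 := Real.cos_lt_cos_of_nonneg_of_le_pi (x := i * (2 * Real.pi / n)) (by positivity) hj
    (by gcongr)
  have h2 := Real.cos_lt_cos_of_nonneg_of_le_pi
    (x := i * (2 * Real.pi / n) - 2 * Real.pi / n) (y := j * (2 * Real.pi / n) - 2 * Real.pi / n)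
    (by nlinarith) (by linarith) (by gcongr)
  rw [Real.cos_sub, Real.cos_sub] at h2
  have key (m : ℕ) : ‖1 + (b : ℂ) * (nroot n - 1) - nroot n ^ m‖ ^ 2 =
      ‖1 + (b : ℂ) * (nroot n - 1)‖ ^ 2 + 1 - 2 * ((1 - b) * Real.cos (m * (2 * Real.pi / n)) +
        b * (Real.cos (m * (2 * Real.pi / n)) * Real.cos (2 * Real.pi / n) +
          Real.sin (m * (2 * Real.pi / n)) * Real.sin (2 * Real.pi / n))) := by
    have hs := Real.sin_sq_add_cos_sq (m * (2 * Real.pi / n))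
    have e : ((m : ℤ) : ℝ) = m := by simp
    rw [← Complex.normSq_eq_norm_sq, ← Complex.normSq_eq_norm_sq, Complex.normSq_apply,
      Complex.normSq_apply, ← zpow_natCast, nroot_zpow, nroot_eq, e]
    simp
    linear_combination hs
  rw [← sq_lt_sq₀ (norm_nonneg _) (norm_nonneg _), key, key]
  rcases hb0.eq_or_lt with rfl | hb
  · linarith
  · nlinarith [mul_nonneg (sub_nonneg.2 hb1) (sub_nonneg.2 h1.le), mul_pos hb (sub_pos.2 h2)]

theorem norm_sub_nroot_pow_le {n k : ℕ} (hk : 1 ≤ k) (hkn : 2 * (k + 1) ≤ n) {b : ℝ}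
    (hb0 : 0 ≤ b) (hb1 : b ≤ 1) :
    ‖1 + (b : ℂ) * (nroot n - 1) - nroot n ^ k‖ ^ 2 + b ^ 2 * (2 - 2 * (nroot n).re) ≤
      ‖1 + (b : ℂ) * (nroot n - 1) - nroot n ^ k * (1 + (b : ℂ) * (nroot n - 1))‖ ^ 2 := by
  obtain ⟨h1, -, h3⟩ := nroot_chord_nonneg hk hkn
  have r1 := nroot_normSq n
  have r2 := nroot_pow_normSq n k
  rw [← Complex.normSq_eq_norm_sq, ← Complex.normSq_eq_norm_sq, Complex.normSq_apply,
    Complex.normSq_apply]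
  simp at h1 h3 ⊢
  generalize (nroot n).re = c at *
  generalize (nroot n).im = s at *
  generalize (nroot n ^ k).re = C at *
  generalize (nroot n ^ k).im = S at *
  have h1' := mul_nonneg (mul_nonneg hb0 (sub_nonneg.2 hb1)) h1
  have h3' := mul_nonneg (mul_nonneg hb0 hb0) h3
  have id : (1 + b * (c - 1) - (C * (1 + b * (c - 1)) - S * (b * s))) *
        (1 + b * (c - 1) - (C * (1 + b * (c - 1)) - S * (b * s))) +
      (b * s - (C * (b * s) + S * (1 + b * (c - 1)))) *
        (b * s - (C * (b * s) + S * (1 + b * (c - 1)))) =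
      (1 + b * (c - 1) - C) * (1 + b * (c - 1) - C) + (b * s - S) * (b * s - S) +
      b ^ 2 * (2 - 2 * c) + 2 * (b * (1 - b) * (c - 1 - (C * c - S * s) + C)) +
      2 * (b * b * (c - 1 - C + (C * c + S * s))) := by
    grind
  linarith

theorem norm_sub_le_of_mem_edge {n k : ℕ} (hk : 1 ≤ k) (hkn : 2 * (k + 1) ≤ n) {a b : ℝ}
    (hab : a ≤ b) (hb0 : 0 ≤ b) (hb1 : b ≤ 1) :
    ‖1 + (b : ℂ) * (nroot n - 1) - nroot n ^ k * (1 + (b : ℂ) * (nroot n - 1))‖ ≤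
      ‖1 + (a : ℂ) * (nroot n - 1) - nroot n ^ k * (1 + (b : ℂ) * (nroot n - 1))‖ := by
  obtain ⟨h1, h2, -⟩ := nroot_chord_nonneg hk hkn
  have r1 := nroot_normSq n
  rw [← sq_le_sq₀ (norm_nonneg _) (norm_nonneg _), ← Complex.normSq_eq_norm_sq,
    ← Complex.normSq_eq_norm_sq, Complex.normSq_apply, Complex.normSq_apply]
  simp at h1 h2 ⊢
  generalize (nroot n).re = c at *
  generalize (nroot n).im = s at *
  generalize (nroot n ^ k).re = C at *
  generalize (nroot n ^ k).im = S at *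
  have hδ := sub_nonneg.2 hab
  have h1' := mul_nonneg (mul_nonneg hδ hb0) h1
  have h2' := mul_nonneg (mul_nonneg hδ (sub_nonneg.2 hb1)) h2
  have h3' : 0 ≤ (b - a) ^ 2 * ((c - 1) ^ 2 + s ^ 2) := by positivity
  have id : (1 + a * (c - 1) - (C * (1 + b * (c - 1)) - S * (b * s))) *
        (1 + a * (c - 1) - (C * (1 + b * (c - 1)) - S * (b * s))) +
      (a * s - (C * (b * s) + S * (1 + b * (c - 1)))) *
        (a * s - (C * (b * s) + S * (1 + b * (c - 1)))) =
      (1 + b * (c - 1) - (C * (1 + b * (c - 1)) - S * (b * s))) *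
        (1 + b * (c - 1) - (C * (1 + b * (c - 1)) - S * (b * s))) +
      (b * s - (C * (b * s) + S * (1 + b * (c - 1)))) *
        (b * s - (C * (b * s) + S * (1 + b * (c - 1)))) +
      (b - a) ^ 2 * ((c - 1) ^ 2 + s ^ 2) +
      2 * ((b - a) * b * (c - 1 - (C * c - S * s) + C)) +
      2 * ((b - a) * (1 - b) * (C * c + S * s - C - c + 1)) := by
    grind
  linarith

theorem norm_sub_convex_lt {w u v : ℂ} {t M : ℝ} (ht0 : 0 ≤ t) (ht1 : t < 1)
    (hu : ‖w - u‖ < M) (hv : ‖w - v‖ ≤ M) : ‖w - (u + t * (v - u))‖ < M := by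
  have h : w - (u + t * (v - u)) = ((1 - t : ℝ) : ℂ) * (w - u) + (t : ℂ) * (w - v) := by
    push_cast
    ring
  have h1 : ‖w - (u + t * (v - u))‖ ≤ (1 - t) * ‖w - u‖ + t * ‖w - v‖ := by
    rw [h]
    refine (norm_add_le _ _).trans_eq ?_
    rw [norm_mul, norm_mul, Complex.norm_of_nonneg (by linarith), Complex.norm_of_nonneg ht0]
  nlinarith

theorem dist_edgePoint_lt_of_mem_Ico {n k : ℕ} (hk : 1 ≤ k) (hkn : 2 * (k + 1) ≤ n) {b d : ℝ}
    (hb0 : 0 ≤ b) (hb1 : b < 1) (hd0 : 0 ≤ d) (hdk : d < k) :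
    dist (edgePoint n b) (edgePoint n (b + d)) < dist (edgePoint n b) (edgePoint n (b + k)) := by
  have hlast : edgePoint n (b + k) = nroot n ^ k * (1 + (b : ℂ) * (nroot n - 1)) := by
    have := edgePoint_add_int n b k
    rwa [edgePoint_of_mem_Icc n hb0 hb1.le, Int.cast_natCast, zpow_natCast] at this
  have hω := nroot_re_lt_one (n := n) (by omega)
  have hle := norm_sub_nroot_pow_le hk hkn hb0 hb1.le
  rw [hlast, edgePoint_of_mem_Icc n hb0 hb1.le, dist_eq_norm, dist_eq_norm]
  set w := 1 + (b : ℂ) * (nroot n - 1) with hw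
  have hvertex : ‖w - nroot n ^ k‖ ≤ ‖w - nroot n ^ k * w‖ := by
    rw [← sq_le_sq₀ (norm_nonneg _) (norm_nonneg _)]
    nlinarith [sq_nonneg b]
  have hmono {j : ℕ} (hj : 1 ≤ j) (hjk : j ≤ k) : ‖w - nroot n ^ j‖ ≤ ‖w - nroot n ^ k * w‖ := by
    rcases hjk.eq_or_lt with rfl | h
    · exact hvertex
    · exact (norm_sub_nroot_pow_lt hj h (by omega) hb0 hb1.le).le.trans hvertex
  obtain ⟨j, hj⟩ := Int.eq_ofNat_of_zero_le (Int.floor_nonneg.2 (add_nonneg hb0 hd0))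
  have hfl : (j : ℝ) + Int.fract (b + d) = b + d := by
    have := Int.floor_add_fract (b + d)
    rw [hj] at this
    exact_mod_cast this
  have ht0 := Int.fract_nonneg (b + d)
  have ht1 := Int.fract_lt_one (b + d)
  have hpt : edgePoint n (b + d) =
      nroot n ^ j + (Int.fract (b + d) : ℝ) * (nroot n ^ (j + 1) - nroot n ^ j) := by
    rw [edgePoint, hj, pow_succ]
    simp only [zpow_natCast]
    ring
  rw [hpt]
  set t := Int.fract (b + d)
  rcases Nat.lt_or_ge j k with hjk | hjk
  · rcases Nat.eq_zero_or_pos j with rfl | hj0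
    · have h1 := hmono le_rfl hk
      have e1 : w - (nroot n ^ 0 + t * (nroot n ^ (0 + 1) - nroot n ^ 0)) =
          ((b - t : ℝ) : ℂ) * (nroot n - 1) := by
        rw [hw]; push_cast; ring
      have e2 : w - nroot n ^ 1 = ((b - 1 : ℝ) : ℂ) * (nroot n - 1) := by
        rw [hw]; push_cast; ring
      have hpos : 0 < ‖nroot n - 1‖ := by
        refine norm_pos_iff.2 fun h => ?_
        have := congrArg Complex.re h
        simp at this
        linarith
      have hbt : b ≤ t := by
        simp at hfl
        linarith
      refine lt_of_lt_of_le ?_ h1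
      rw [e1, e2, norm_mul, norm_mul, Complex.norm_real, Complex.norm_real, Real.norm_eq_abs,
        Real.norm_eq_abs, abs_of_nonpos (by linarith), abs_of_nonpos (by linarith)]
      nlinarith
    · refine norm_sub_convex_lt ht0 ht1 ?_ (hmono (by omega) (by omega))
      exact (norm_sub_nroot_pow_lt hj0 (Nat.lt_succ_self j) (by omega) hb0 hb1.le).trans_le
        (hmono (by omega) (by omega))
  · have hjk' : (k : ℝ) ≤ j := by exact_mod_cast hjk
    have hjk2 : j = k := by
      refine le_antisymm ?_ hjk
      have : (j : ℝ) < k + 1 := by linarith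
      exact Nat.lt_succ_iff.1 (by exact_mod_cast this)
    subst hjk2
    have htb : t < b := by linarith
    have hb : 0 < b := by linarith
    have hstrict : ‖w - nroot n ^ j‖ < ‖w - nroot n ^ j * w‖ := by
      rw [← sq_lt_sq₀ (norm_nonneg _) (norm_nonneg _)]
      nlinarith [mul_pos (pow_pos hb 2) (sub_pos.2 hω)]
    have e : nroot n ^ j + t * (nroot n ^ (j + 1) - nroot n ^ j) =
        nroot n ^ j + ((t / b : ℝ) : ℂ) * (nroot n ^ j * w - nroot n ^ j) := by
      have hbc : (b : ℂ) ≠ 0 := by exact_mod_cast hb.ne'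
      rw [hw]
      push_cast
      field_simp
      ring
    rw [e]
    exact norm_sub_convex_lt (by positivity) ((div_lt_one hb).2 htb) hstrict le_rfl

/-- When `k + 1` edges cover at most half of the polygon, the distance from `x` to the points on
the `k` edge lengths following it is smaller than at the end of that arc. -/
theorem dist_edgePoint_lt {n k : ℕ} (hk : 1 ≤ k) (hkn : 2 * (k + 1) ≤ n) (x : ℝ) {d : ℝ}
    (hd0 : 0 ≤ d) (hdk : d < k) :
    dist (edgePoint n x) (edgePoint n (x + d)) < dist (edgePoint n x) (edgePoint n (x + k)) := by
  have h := dist_edgePoint_lt_of_mem_Ico hk hkn (Int.fract_nonneg x) (Int.fract_lt_one x) hd0 hdk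
  rw [← dist_edgePoint_add_int n _ _ ⌊x⌋, ← dist_edgePoint_add_int n _ (_ + (k : ℝ)) ⌊x⌋] at h
  have e (y : ℝ) : Int.fract x + y + ⌊x⌋ = x + y := by linarith [Int.fract_add_floor x]
  rwa [e, e, Int.fract_add_floor] at h

theorem dist_edgePoint_le_of_le {n k : ℕ} (hk : 1 ≤ k) (hkn : 2 * (k + 1) ≤ n) {x z : ℝ}
    (hxz : x ≤ z) (hz : z ≤ ⌊x⌋ + 1) :
    dist (edgePoint n z) (edgePoint n (z + k)) ≤ dist (edgePoint n x) (edgePoint n (z + k)) := by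
  have hx0 := Int.floor_le x
  have hx1 := Int.lt_floor_add_one x
  have h := norm_sub_le_of_mem_edge hk hkn (a := x - ⌊x⌋) (b := z - ⌊x⌋) (by linarith)
    (by linarith) (by linarith)
  have hlast : edgePoint n (z - ⌊x⌋ + k) =
      nroot n ^ k * (1 + ((z - ⌊x⌋ : ℝ) : ℂ) * (nroot n - 1)) := by
    have := edgePoint_add_int n (z - ⌊x⌋) k
    rwa [edgePoint_of_mem_Icc n (b := z - ⌊x⌋) (by linarith) (by linarith), Int.cast_natCast,
      zpow_natCast] at this
  rw [← hlast, ← edgePoint_of_mem_Icc n (by linarith) (by linarith),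
    ← edgePoint_of_mem_Icc n (by linarith) (by linarith), ← dist_eq_norm, ← dist_eq_norm,
    ← dist_edgePoint_add_int n (z - ⌊x⌋) _ ⌊x⌋, ← dist_edgePoint_add_int n (x - ⌊x⌋) _ ⌊x⌋] at h
  have e : z - ⌊x⌋ + k + ⌊x⌋ = z + k := by ring
  rwa [e, sub_add_cancel, sub_add_cancel] at h

theorem dist_edgePoint_add_natCast (n k : ℕ) (x : ℝ) :
    dist (edgePoint n x) (edgePoint n (x + k)) = ‖1 - nroot n ^ k‖ * ‖edgePoint n x‖ := by
  have h := edgePoint_add_int n x k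
  rw [Int.cast_natCast, zpow_natCast] at h
  rw [h, dist_eq_norm, ← norm_mul]
  congr 1
  ring

theorem norm_edgePoint_add_int (n : ℕ) (x : ℝ) (k : ℤ) :
    ‖edgePoint n (x + k)‖ = ‖edgePoint n x‖ := by
  rw [edgePoint_add_int, norm_nroot_zpow_mul]

theorem dist_edgePoint_add_natCast_add_int (n k : ℕ) (x : ℝ) (j : ℤ) :
    dist (edgePoint n (x + j)) (edgePoint n (x + j + k)) =
      dist (edgePoint n x) (edgePoint n (x + k)) := by
  rw [dist_edgePoint_add_natCast, dist_edgePoint_add_natCast, norm_edgePoint_add_int]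

theorem norm_edgePoint_le_one (n : ℕ) (x : ℝ) : ‖edgePoint n x‖ ≤ 1 := by
  have h0 := Int.fract_nonneg x
  have h1 := (Int.fract_lt_one x).le
  rw [← sq_le_one_iff₀ (norm_nonneg _), norm_edgePoint_sq]
  have := mul_nonneg (mul_nonneg h0 (sub_nonneg.2 h1)) (sq_nonneg (Real.sin (Real.pi / n)))
  linarith

theorem continuousOn_edgePoint (n : ℕ) (k : ℤ) :
    ContinuousOn (edgePoint n) (Set.Icc (k : ℝ) (k + 1)) := by
  have h : ContinuousOn
      (fun x : ℝ => nroot n ^ k * (1 + ((x - k : ℝ) : ℂ) * (nroot n - 1)))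
      (Set.Icc (k : ℝ) (k + 1)) := by fun_prop
  refine h.congr fun x hx => ?_
  have := edgePoint_int_add n k (b := x - k) (by linarith [hx.1]) (by linarith [hx.2])
  rwa [add_sub_cancel] at this

theorem exists_norm_edgePoint_eq {n : ℕ} {x w ρ : ℝ} (hxw : x ≤ w) (hx : ‖edgePoint n x‖ < ρ)
    (hw : ρ < ‖edgePoint n w‖) :
    ∃ z, x < z ∧ z < w ∧ z ≤ ⌊x⌋ + 1 ∧ ‖edgePoint n z‖ = ρ := by
  have hv : ρ < ‖edgePoint n (min w (⌊x⌋ + 1))‖ := by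
    rcases le_total w (⌊x⌋ + 1) with h | h
    · rwa [min_eq_left h]
    · have e : ((⌊x⌋ : ℝ) + 1) = ((⌊x⌋ + 1 : ℤ) : ℝ) := by push_cast; ring
      rw [min_eq_right h, e, edgePoint_intCast, norm_zpow, norm_nroot, one_zpow]
      exact hw.trans_le (norm_edgePoint_le_one n w)
  have hcont : ContinuousOn (fun y => ‖edgePoint n y‖) (Set.Icc x (min w (⌊x⌋ + 1))) :=
    ((continuousOn_edgePoint n ⌊x⌋).mono
      (Set.Icc_subset_Icc (Int.floor_le x) (min_le_right _ _))).norm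
  obtain ⟨z, hz, hzρ⟩ := intermediate_value_Ioo (le_min hxw (Int.lt_floor_add_one x).le) hcont
    ⟨hx, hv⟩
  exact ⟨z, hz.1, hz.2.trans_le (min_le_left _ _), hz.2.le.trans (min_le_right _ _), hzρ⟩

theorem norm_one_sub_nroot_pow_pos {n k : ℕ} (hk : 1 ≤ k) (hkn : 2 * (k + 1) ≤ n) :
    0 < ‖1 - nroot n ^ k‖ := by
  have h := dist_edgePoint_lt hk hkn 0 le_rfl (by exact_mod_cast hk : (0 : ℝ) < k)
  rw [add_zero, dist_self, dist_edgePoint_add_natCast] at h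
  exact pos_of_mul_pos_left h (norm_nonneg _)

/-- The point `x + d` is the first point at distance `r` counterclockwise from `x`. -/
structure IsFirstAt (n : ℕ) (r x d : ℝ) : Prop where
  dist_eq : dist (edgePoint n x) (edgePoint n (x + d)) = r
  dist_lt : ∀ e, 0 < e → e < d → dist (edgePoint n x) (edgePoint n (x + e)) < r

theorem IsFirstAt.le_natCast {n k : ℕ} {r x d : ℝ} (h : IsFirstAt n r x d) (hk : 1 ≤ k)
    (hr : r ≤ dist (edgePoint n x) (edgePoint n (x + k))) : d ≤ k := by
  by_contra! hd
  exact (h.dist_lt k (by exact_mod_cast hk) hd).not_ge hr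

theorem IsFirstAt.natCast_le {n k : ℕ} {r x d : ℝ} (h : IsFirstAt n r x d) (hk : 1 ≤ k)
    (hkn : 2 * (k + 1) ≤ n) (hd : 0 ≤ d)
    (hr : dist (edgePoint n x) (edgePoint n (x + k)) ≤ r) : (k : ℝ) ≤ d := by
  by_contra! hdk
  have := dist_edgePoint_lt hk hkn x hd hdk
  rw [h.dist_eq] at this
  exact this.not_ge hr

theorem IsFirstAt.dist_natCast_le {n k : ℕ} {r x d : ℝ} (h : IsFirstAt n r x d) (hk : 1 ≤ k)
    (hkn : 2 * (k + 1) ≤ n) (hd : 0 ≤ d)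
    (hr : dist (edgePoint n x) (edgePoint n (x + k)) ≤ r) :
    dist (edgePoint n (x + d)) (edgePoint n (x + d + k)) ≤ r := by
  have hkd := h.natCast_le hk hkn hd hr
  rcases hr.eq_or_lt with hr | hr
  · obtain rfl : d = k := le_antisymm (h.le_natCast hk hr.ge) hkd
    have := dist_edgePoint_add_natCast_add_int n k x k
    rw [Int.cast_natCast] at this
    exact (this.trans hr).le
  by_contra! hlt
  have hT := norm_one_sub_nroot_pow_pos hk hkn
  have hw : ‖edgePoint n (x + d - k)‖ = ‖edgePoint n (x + d)‖ := by
    have := norm_edgePoint_add_int n (x + d - k) k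
    rw [Int.cast_natCast, sub_add_cancel] at this
    exact this.symm
  rw [dist_edgePoint_add_natCast, mul_comm, ← lt_div_iff₀ hT] at hr
  rw [dist_edgePoint_add_natCast, mul_comm, ← div_lt_iff₀ hT, ← hw] at hlt
  obtain ⟨z, hxz, hzw, hz, hzr⟩ := exists_norm_edgePoint_eq (by linarith) hr hlt
  have h1 := dist_edgePoint_le_of_le hk hkn hxz.le hz
  have h2 := h.dist_lt (z - x + k) (by positivity [sub_pos.2 hxz]) (by linarith)
  rw [dist_edgePoint_add_natCast, hzr, mul_div_cancel₀ _ hT.ne'] at h1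
  have e : x + (z - x + k) = z + k := by ring
  rw [e] at h2
  linarith

/-- A closed chain of first points at distance `r` advancing on average by `k` edges is regular. -/
theorem eq_add_natCast_of_isFirstAt {n k m : ℕ} {r : ℝ} (hk : 1 ≤ k) (hkn : 2 * (k + 1) ≤ n)
    (x d : ℕ → ℝ) (hd : ∀ i < m, 0 ≤ d i) (hx : ∀ i, x (i + 1) = x i + d i)
    (hfirst : ∀ i < m, IsFirstAt n r (x i) (d i)) (hsum : ∑ i ∈ Finset.range m, d i = m * k) :
    ∀ i < m, d i = k := by
  have hclosed : x m = x 0 + ∑ i ∈ Finset.range m, d i := by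
    clear hsum hd hfirst
    induction m with
    | zero => simp
    | succ m ih => rw [Finset.sum_range_succ, hx, ih]; ring
  have hxm : dist (edgePoint n (x m)) (edgePoint n (x m + k)) =
      dist (edgePoint n (x 0)) (edgePoint n (x 0 + k)) := by
    have := dist_edgePoint_add_natCast_add_int n k (x 0) (m * k)
    rw [hclosed, hsum]
    push_cast at this
    exact this
  have hconst : ∑ i ∈ Finset.range m, (k : ℝ) = m * k := by simp
  have hprop (i j : ℕ) (hij : i ≤ j) (hjm : j ≤ m)
      (hi : dist (edgePoint n (x i)) (edgePoint n (x i + k)) ≤ r) :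
      dist (edgePoint n (x j)) (edgePoint n (x j + k)) ≤ r := by
    induction j, hij using Nat.le_induction with
    | base => exact hi
    | succ j hij ih =>
      rw [hx]
      exact (hfirst j hjm).dist_natCast_le hk hkn (hd j hjm) (ih (by omega))
  by_cases hex : ∃ i < m, dist (edgePoint n (x i)) (edgePoint n (x i + k)) < r
  · obtain ⟨i, him, hi⟩ := hex
    have h0 := hprop i m him.le le_rfl hi.le
    rw [hxm] at h0
    have hle : ∀ i ∈ Finset.range m, (k : ℝ) ≤ d i := fun j hj => by
      have hj := Finset.mem_range.1 hj
      exact (hfirst j hj).natCast_le hk hkn (hd j hj) (hprop 0 j (Nat.zero_le _) hj.le h0)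
    have := (Finset.sum_eq_sum_iff_of_le hle).1 (hconst.trans hsum.symm)
    exact fun j hj => (this j (Finset.mem_range.2 hj)).symm
  · push Not at hex
    have hle : ∀ i ∈ Finset.range m, d i ≤ k := fun j hj =>
      (hfirst j (Finset.mem_range.1 hj)).le_natCast hk (hex j (Finset.mem_range.1 hj))
    have := (Finset.sum_eq_sum_iff_of_le hle).1 (hsum.trans hconst.symm)
    exact fun j hj => this j (Finset.mem_range.2 hj)

theorem IsStar.exists_eq_edgePoint {l q n : ℕ} (hl : 1 ≤ l) (hq : 2 ≤ q)
    (hn : n = q * (2 * l + 1)) {r : ℝ} {p : ℂ} {u : ℕ → ℂ} (h : IsStar n l r p u) :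
    ∃ x : ℝ, dist (edgePoint n x) (edgePoint n (x + (q * l : ℕ))) = r ∧
      ∀ i ≤ 2 * l, u i = edgePoint n (x + i * (q * l : ℕ)) := by
  obtain ⟨-, -, hmem, hdist, hbtw, hsum⟩ := h
  have hk : 1 ≤ q * l := Nat.mul_pos (by omega) hl
  have hkn : 2 * (q * l + 1) ≤ n := by rw [hn]; nlinarith
  have hn3 : 3 ≤ n := by omega
  have hn0 : (0 : ℝ) < n := by
    have : 0 < n := by omega
    exact_mod_cast this
  have hu0 := hmem 0 (Nat.zero_le _)
  rw [← range_edgePoint (by omega)] at hu0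
  obtain ⟨x₀, hx₀⟩ := hu0
  set d : ℕ → ℝ := fun i => n * polyDist n (u i) (u (i + 1)) with hd
  set x : ℕ → ℝ := fun i => x₀ + ∑ j ∈ Finset.range i, d j with hx
  have hxs (i : ℕ) : x (i + 1) = x i + d i := by
    simp only [hx, Finset.sum_range_succ]
    ring
  have hpolyDist (i : ℕ) : 0 ≤ polyDist n (u i) (u (i + 1)) ∧
      polyDist n (u i) (u (i + 1)) < 1 := ⟨Int.fract_nonneg _, Int.fract_lt_one _⟩
  have hd0 (i : ℕ) : 0 ≤ d i := mul_nonneg hn0.le (hpolyDist i).1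
  have hdn (i : ℕ) : d i < n := mul_lt_of_lt_one_right hn0 (hpolyDist i).2
  have hux (i : ℕ) (hi : i ≤ 2 * l + 1) : edgePoint n (x i) = u i := by
    induction i with
    | zero => simpa [hx] using hx₀
    | succ i ih =>
      have := edgePoint_add_polyDist hn3 (x i) (hmem (i + 1) hi)
      rw [ih (by omega)] at this
      rw [hxs, this]
  have hfirst : ∀ i < 2 * l + 1, IsFirstAt n r (x i) (d i) := fun i hi => by
    refine ⟨?_, fun e he0 hed => ?_⟩
    · rw [← hxs, hux i hi.le, hux (i + 1) hi]
      exact hdist i (by omega)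
    · have hmemz : edgePoint n (x i + e) ∈ polygon n := by
        rw [← range_edgePoint (by omega)]
        exact ⟨_, rfl⟩
      have hpd := polyDist_edgePoint_add hn3 (x i) he0.le (hed.trans (hdn i))
      rw [hux i hi.le] at hpd ⊢
      refine hbtw i (by omega) _ hmemz ⟨?_, ?_⟩
      · rw [hpd]
        positivity
      · rw [hpd, div_lt_iff₀ hn0, mul_comm]
        exact hed
  have hsumd : ∑ i ∈ Finset.range (2 * l + 1), d i = (2 * l + 1 : ℕ) * (q * l : ℕ) := by
    rw [hd, ← Finset.mul_sum, hsum, hn]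
    push_cast
    ring
  have hdk := eq_add_natCast_of_isFirstAt hk hkn x d (fun i _ => hd0 i) hxs hfirst hsumd
  have hxi (i : ℕ) (hi : i ≤ 2 * l + 1) : x i = x₀ + i * (q * l : ℕ) := by
    induction i with
    | zero => simp [hx]
    | succ i ih =>
      rw [hxs, ih (by omega), hdk i (by omega)]
      push_cast
      ring
  refine ⟨x₀, ?_, fun i hi => ?_⟩
  · have := (hfirst 0 (by omega)).dist_eq
    rwa [hdk 0 (by omega), hxi 0 (by omega), Nat.cast_zero, zero_mul, add_zero] at this
  · rw [← hux i (by omega), hxi i (by omega)]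

theorem isStar_edgePoint {l q n : ℕ} (hl : 1 ≤ l) (hq : 2 ≤ q) (hn : n = q * (2 * l + 1))
    {r x : ℝ} (h : dist (edgePoint n x) (edgePoint n (x + (q * l : ℕ))) = r) :
    IsStar n l r (edgePoint n x) fun i => edgePoint n (x + i * (q * l : ℕ)) := by
  have hk : 1 ≤ q * l := Nat.mul_pos (by omega) hl
  have hkn : 2 * (q * l + 1) ≤ n := by rw [hn]; nlinarith
  have hn3 : 3 ≤ n := by omega
  have hn0 : (0 : ℝ) < n := by
    have : 0 < n := by omega
    exact_mod_cast this
  have hklt : ((q * l : ℕ) : ℝ) < n := by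
    have : q * l < n := by omega
    exact_mod_cast this
  have hmem (y : ℝ) : edgePoint n y ∈ polygon n := by
    rw [← range_edgePoint (by omega)]
    exact ⟨_, rfl⟩
  have hsucc (i : ℕ) : x + (i + 1 : ℕ) * (q * l : ℕ) = x + i * (q * l : ℕ) + (q * l : ℕ) := by
    push_cast
    ring
  have hpd (i : ℕ) := polyDist_edgePoint_add hn3 (x + i * (q * l : ℕ))
    (Nat.cast_nonneg (q * l)) hklt
  have hd (i : ℕ) : dist (edgePoint n (x + i * (q * l : ℕ)))
      (edgePoint n (x + i * (q * l : ℕ) + (q * l : ℕ))) = r := by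
    have := dist_edgePoint_add_natCast_add_int n (q * l) x (i * (q * l : ℕ))
    rw [h] at this
    exact_mod_cast this
  refine ⟨by simp, ?_, fun i _ => hmem _, fun i _ => ?_, fun i _ z hz hbtw => ?_, ?_⟩
  · have := edgePoint_add_mul_int (n := n) (by omega) x l
    have e : x + (2 * l + 1 : ℕ) * (q * l : ℕ) = x + n * (l : ℤ) := by
      rw [hn]
      push_cast
      ring
    exact (congrArg (edgePoint n) e).trans this
  · simp only [hsucc]
    exact hd i
  · obtain ⟨h0, h1⟩ := hbtw
    simp only [hsucc] at h0 h1 ⊢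
    rw [hpd, lt_div_iff₀ hn0, mul_comm] at h1
    have := dist_edgePoint_lt hk hkn (x + i * (q * l : ℕ)) (mul_nonneg hn0.le h0.le) h1
    rwa [edgePoint_add_polyDist hn3 _ hz, hd] at this
  · simp only [hsucc, hpd]
    rw [Finset.sum_const, Finset.card_range, nsmul_eq_mul, mul_div_assoc', div_eq_iff hn0.ne', hn]
    push_cast
    ring

/-- The orbit of a point of `P_n` under the rotation by `q` edges. -/
def edgeOrbit (n q : ℕ) (x : ℝ) : Set ℂ := Set.range fun j : ℤ => edgePoint n (x + q * j)

theorem image_edgePoint_eq_edgeOrbit {l q n : ℕ} (hq : q ≠ 0) (hn : n = q * (2 * l + 1)) (x : ℝ) :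
    (fun i : ℕ => edgePoint n (x + i * (q * l : ℕ))) '' Set.Iic (2 * l) = edgeOrbit n q x := by
  have hn0 : n ≠ 0 := by
    rw [hn]
    exact Nat.mul_ne_zero hq (by omega)
  ext z
  constructor
  · rintro ⟨i, -, rfl⟩
    refine ⟨i * l, ?_⟩
    dsimp only
    congr 1
    push_cast
    ring
  · rintro ⟨j, rfl⟩
    have hm0 : (0 : ℤ) < 2 * l + 1 := by positivity
    have h0 := Int.emod_nonneg (-2 * j) hm0.ne'
    have h1 := Int.emod_lt_of_pos (-2 * j) hm0
    obtain ⟨i, hi⟩ := Int.eq_ofNat_of_zero_le h0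
    refine ⟨i, Set.mem_Iic.2 (by omega), ?_⟩
    have hdiv := Int.mul_ediv_add_emod (-2 * j) (2 * l + 1)
    rw [hi] at hdiv
    have hdiv' : (2 * (l : ℝ) + 1) * (((-2 * j) / (2 * l + 1) : ℤ) : ℝ) + i = -2 * j := by
      exact_mod_cast hdiv
    dsimp only
    rw [← edgePoint_add_mul_int hn0 (x + q * j) (-(j + (-2 * j) / (2 * l + 1) * l))]
    congr 1
    rw [hn]
    push_cast
    linear_combination (q * l : ℝ) * hdiv'

theorem edgeOrbit_add_mul_int (n q : ℕ) (x : ℝ) (k : ℤ) :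
    edgeOrbit n q (x + q * k) = edgeOrbit n q x := by
  refine Set.Subset.antisymm ?_ ?_
  · rintro _ ⟨j, rfl⟩
    refine ⟨k + j, ?_⟩
    dsimp only
    congr 1
    push_cast
    ring
  · rintro _ ⟨j, rfl⟩
    refine ⟨j - k, ?_⟩
    dsimp only
    congr 1
    push_cast
    ring

theorem starSets_eq_image {l q n : ℕ} (hl : 1 ≤ l) (hq : 2 ≤ q) (hn : n = q * (2 * l + 1))
    (r : ℝ) :
    starSets n l r = edgeOrbit n q ''
      {x ∈ Set.Ico (0 : ℝ) q | dist (edgePoint n x) (edgePoint n (x + (q * l : ℕ))) = r} := by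
  have hq0 : (0 : ℝ) < q := by
    have : 0 < q := by omega
    exact_mod_cast this
  ext A
  constructor
  · rintro ⟨p, -, u, hu, rfl⟩
    obtain ⟨x, hx, hux⟩ := hu.exists_eq_edgePoint hl hq hn
    have hy : x + q * ((-⌊x / q⌋ : ℤ) : ℝ) = q * Int.fract (x / q) := by
      rw [Int.fract]
      push_cast
      field_simp
      ring
    refine ⟨x + q * ((-⌊x / q⌋ : ℤ) : ℝ), ⟨?_, ?_⟩, ?_⟩
    · rw [hy]
      exact ⟨mul_nonneg hq0.le (Int.fract_nonneg _), mul_lt_of_lt_one_right hq0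
        (Int.fract_lt_one _)⟩
    · have := dist_edgePoint_add_natCast_add_int n (q * l) x (q * -⌊x / q⌋)
      rw [hx] at this
      exact_mod_cast this
    · rw [edgeOrbit_add_mul_int, ← image_edgePoint_eq_edgeOrbit (by omega) hn]
      exact Set.image_congr fun i hi => (hux i hi).symm
  · rintro ⟨x, ⟨-, hx⟩, rfl⟩
    refine ⟨edgePoint n x, ?_, _, isStar_edgePoint hl hq hn hx,
      (image_edgePoint_eq_edgeOrbit (by omega) hn x).symm⟩
    rw [← range_edgePoint (by rw [hn]; exact Nat.mul_ne_zero (by omega) (by omega))]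
    exact ⟨x, rfl⟩

theorem injOn_edgeOrbit {q m n : ℕ} (hn3 : 3 ≤ n) (hn : n = q * m) :
    Set.InjOn (edgeOrbit n q) (Set.Ico 0 q) := by
  intro x hx y hy hxy
  have hmem : edgePoint n x ∈ edgeOrbit n q y := by
    rw [← hxy]
    exact ⟨0, by simp⟩
  obtain ⟨j, hj⟩ := hmem
  obtain ⟨N, hN⟩ := edgePoint_eq_edgePoint hn3 hj
  have hxy' : y - x = q * ((m * N - j : ℤ) : ℝ) := by
    rw [hn] at hN
    push_cast at hN ⊢
    linarith
  have hq0 : (0 : ℝ) < q := hx.1.trans_lt hx.2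
  have h1 : ((m * N - j : ℤ) : ℝ) < 1 := by
    by_contra! h
    nlinarith [hx.1, hy.2]
  have h2 : (-1 : ℝ) < ((m * N - j : ℤ) : ℝ) := by
    by_contra! h
    nlinarith [hx.2, hy.1]
  have h1' : m * N - j < 1 := by exact_mod_cast h1
  have h2' : -1 < m * N - j := by exact_mod_cast h2
  have h3 : m * N - j = 0 := by omega
  rw [h3] at hxy'
  simp at hxy'
  linarith

theorem ncard_fract_mem (q : ℕ) (B : Finset ℝ) (hB : ∀ b ∈ B, 0 ≤ b ∧ b < 1) :
    {x ∈ Set.Ico (0 : ℝ) q | Int.fract x ∈ B}.ncard = q * B.card := by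
  have hset : {x ∈ Set.Ico (0 : ℝ) q | Int.fract x ∈ B} =
      (fun p : ℕ × ℝ => (p.1 : ℝ) + p.2) '' (Finset.range q ×ˢ B : Finset (ℕ × ℝ)) := by
    ext x
    simp only [Set.mem_image, Finset.mem_coe, Finset.mem_product, Finset.mem_range, Prod.exists]
    constructor
    · rintro ⟨⟨hx0, hxq⟩, hx⟩
      refine ⟨⌊x⌋₊, Int.fract x, ⟨(Nat.floor_lt hx0).2 hxq, hx⟩, ?_⟩
      rw [natCast_floor_eq_intCast_floor hx0, Int.floor_add_fract]
    · rintro ⟨i, b, ⟨hi, hb⟩, rfl⟩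
      obtain ⟨hb0, hb1⟩ := hB b hb
      have hi' : (i : ℝ) + 1 ≤ q := by exact_mod_cast hi
      refine ⟨⟨by positivity, by linarith⟩, ?_⟩
      rwa [Int.fract_natCast_add, Int.fract_eq_self.2 ⟨hb0, hb1⟩]
  have hinj : Set.InjOn (fun p : ℕ × ℝ => (p.1 : ℝ) + p.2)
      (Finset.range q ×ˢ B : Finset (ℕ × ℝ)) := by
    rintro ⟨i, b⟩ hib ⟨j, c⟩ hjc h
    simp only [Finset.mem_coe, Finset.mem_product] at hib hjc
    have hbc : b = c := by
      have := congrArg Int.fract h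
      simpa [Int.fract_natCast_add, Int.fract_eq_self.2 (hB b hib.2),
        Int.fract_eq_self.2 (hB c hjc.2)] using this
    subst hbc
    have : (i : ℝ) = j := by simpa using h
    simpa using this
  rw [hset, hinj.ncard_image, Set.ncard_coe_finset, Finset.card_product,
    Finset.card_range]

theorem norm_one_sub_nroot_pow {l q n : ℕ} (hq : q ≠ 0) (hn : n = q * (2 * l + 1)) :
    ‖1 - nroot n ^ (q * l)‖ = 2 * Real.sin (Real.pi * l / (2 * l + 1)) := by
  have hpi := Real.pi_pos
  have hl0 : (0 : ℝ) ≤ l := Nat.cast_nonneg l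
  have hsin : 0 ≤ Real.sin (Real.pi * l / (2 * l + 1)) := by
    apply Real.sin_nonneg_of_nonneg_of_le_pi (by positivity)
    rw [div_le_iff₀ (by positivity)]
    nlinarith
  have hq0 : (q : ℝ) ≠ 0 := by exact_mod_cast hq
  have hangle : ((q * l : ℕ) : ℝ) * (2 * Real.pi / n) = 2 * (Real.pi * l / (2 * l + 1)) := by
    rw [hn]
    push_cast
    field_simp
  have e : (((q * l : ℕ) : ℤ) : ℝ) = ((q * l : ℕ) : ℝ) := by simp
  rw [← sq_eq_sq₀ (norm_nonneg _) (by positivity), ← Complex.normSq_eq_norm_sq,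
    Complex.normSq_apply, ← zpow_natCast, nroot_zpow, e, hangle, Real.cos_two_mul,
    Real.sin_two_mul]
  have h := Real.sin_sq_add_cos_sq (Real.pi * l / (2 * l + 1))
  simp
  grind

theorem dist_edgePoint_eq_iff {l q n : ℕ} (hq : q ≠ 0) (hn : n = q * (2 * l + 1)) {r : ℝ}
    (hr : 0 < r) (x : ℝ) :
    dist (edgePoint n x) (edgePoint n (x + (q * l : ℕ))) = r ↔
      (2 * Real.sin (Real.pi * l / (2 * l + 1))) ^ 2 *
        (1 - 4 * (Int.fract x * (1 - Int.fract x)) * Real.sin (Real.pi / n) ^ 2) = r ^ 2 := by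
  rw [← sq_eq_sq₀ dist_nonneg hr.le, dist_edgePoint_add_natCast, mul_pow, norm_edgePoint_sq,
    norm_one_sub_nroot_pow hq hn]

/-- Counting stars: for `n = q(2l+1)` with `l ≥ 1` and `q ≥ 2`, set
`s = 2 sin(πl/(2l+1)) cos(π/n)` and `t = 2 sin(πl/(2l+1))`.  Then for each `r > 0`, the
number of distinct inscribed equilateral `(2l+1)`-pointed stars of side length `r` in `P_n`
(where two stars are identified when their point sets `{u 0, …, u (2l)}` agree) is `q` if
`r = s` or `r = t`; `2q` if `s < r < t`; and `0` if `r < s` or `r > t`. -/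
theorem star_count (l q : ℕ) (hl : 1 ≤ l) (hq : 2 ≤ q) (n : ℕ)
    (hn : n = q * (2 * l + 1)) (r : ℝ) (hr : 0 < r) :
    ((r = 2 * Real.sin (Real.pi * l / (2 * l + 1)) * Real.cos (Real.pi / n) ∨
        r = 2 * Real.sin (Real.pi * l / (2 * l + 1))) →
      (starSets n l r).ncard = q) ∧
    ((2 * Real.sin (Real.pi * l / (2 * l + 1)) * Real.cos (Real.pi / n) < r ∧
        r < 2 * Real.sin (Real.pi * l / (2 * l + 1))) →
      (starSets n l r).ncard = 2 * q) ∧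
    ((r < 2 * Real.sin (Real.pi * l / (2 * l + 1)) * Real.cos (Real.pi / n) ∨
        2 * Real.sin (Real.pi * l / (2 * l + 1)) < r) →
      starSets n l r = ∅) := by
  have hk : 1 ≤ q * l := Nat.mul_pos (by omega) hl
  have hkn : 2 * (q * l + 1) ≤ n := by rw [hn]; nlinarith
  have hn3 : 3 ≤ n := by omega
  have hn3' : (3 : ℝ) ≤ n := by exact_mod_cast hn3
  have hpi := Real.pi_pos
  have hncard (B : Finset ℝ) (hB : ∀ b ∈ B, 0 ≤ b ∧ b < 1)
      (hiff : ∀ x : ℝ, (2 * Real.sin (Real.pi * l / (2 * l + 1))) ^ 2 *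
        (1 - 4 * (Int.fract x * (1 - Int.fract x)) * Real.sin (Real.pi / n) ^ 2) = r ^ 2 ↔
          Int.fract x ∈ B) : (starSets n l r).ncard = q * B.card := by
    rw [starSets_eq_image hl hq hn,
      ((injOn_edgeOrbit hn3 hn).mono (Set.sep_subset _ _)).ncard_image, ← ncard_fract_mem q B hB]
    congr 1
    ext x
    exact and_congr_right fun _ => (dist_edgePoint_eq_iff (by omega) hn hr x).trans (hiff x)
  have hempty (h : ∀ x : ℝ, (2 * Real.sin (Real.pi * l / (2 * l + 1))) ^ 2 *
      (1 - 4 * (Int.fract x * (1 - Int.fract x)) * Real.sin (Real.pi / n) ^ 2) ≠ r ^ 2) :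
      starSets n l r = ∅ := by
    rw [starSets_eq_image hl hq hn, Set.image_eq_empty, Set.eq_empty_iff_forall_notMem]
    rintro x ⟨-, hx⟩
    exact h x ((dist_edgePoint_eq_iff (by omega) hn hr x).1 hx)
  have hT : 0 < 2 * Real.sin (Real.pi * l / (2 * l + 1)) := by
    rw [← norm_one_sub_nroot_pow (by omega) hn]
    exact norm_one_sub_nroot_pow_pos hk hkn
  have hσ : 0 < Real.sin (Real.pi / n) := by
    apply Real.sin_pos_of_pos_of_lt_pi (by positivity)
    rw [div_lt_iff₀ (by linarith)]
    nlinarith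
  have hc : 0 ≤ Real.cos (Real.pi / n) := by
    apply Real.cos_nonneg_of_neg_pi_div_two_le_of_le
    · have : 0 ≤ Real.pi / n := by positivity
      linarith
    · rw [div_le_div_iff₀ (by linarith) two_pos]
      nlinarith
  have hcσ := Real.cos_sq' (Real.pi / n)
  generalize 2 * Real.sin (Real.pi * l / (2 * l + 1)) = T at *
  generalize Real.sin (Real.pi / n) = σ at *
  generalize Real.cos (Real.pi / n) = c at *
  have hT2 : T ^ 2 ≠ 0 := by positivity
  have hσ2 : σ ^ 2 ≠ 0 := by positivity
  refine ⟨?_, ?_, ?_⟩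
  · rintro (rfl | rfl)
    · rw [hncard {1 / 2} (by norm_num), Finset.card_singleton, mul_one]
      intro x
      rw [mul_pow, hcσ, mul_right_inj' hT2, Finset.mem_singleton]
      constructor
      · intro h
        have h1 : (2 * Int.fract x - 1) ^ 2 * σ ^ 2 = 0 := by linear_combination h
        have h2 := pow_eq_zero_iff two_ne_zero |>.1 ((mul_eq_zero_iff_right hσ2).1 h1)
        linarith
      · intro h
        rw [h]
        ring
    · rw [hncard {0} (by norm_num), Finset.card_singleton, mul_one]
      intro x
      rw [Finset.mem_singleton]
      constructor
      · intro h
        rw [mul_eq_left₀ hT2] at h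
        have h1 : Int.fract x * ((1 - Int.fract x) * (4 * σ ^ 2)) = 0 := by linear_combination -h
        have h2 : 0 < 1 - Int.fract x := by linarith [Int.fract_lt_one x]
        exact (mul_eq_zero_iff_right (by positivity)).1 h1
      · intro h
        rw [h]
        ring
  · rintro ⟨h1, h2⟩
    have h1' : T ^ 2 * (1 - σ ^ 2) < r ^ 2 := by
      rw [← hcσ, ← mul_pow]
      gcongr
    have h2' : r ^ 2 < T ^ 2 := by gcongr
    set δ := (r ^ 2 - T ^ 2 * (1 - σ ^ 2)) / (T ^ 2 * σ ^ 2) with hδ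
    have hδr : T ^ 2 * σ ^ 2 * δ = r ^ 2 - T ^ 2 * (1 - σ ^ 2) := by
      rw [hδ]
      field_simp
    have hδ0 : 0 < δ := div_pos (by linarith) (by positivity)
    have hδ1 : δ < 1 := by
      rw [hδ, div_lt_one (by positivity)]
      linarith
    have hs0 : 0 < √δ := Real.sqrt_pos.2 hδ0
    have hs1 : √δ < 1 := by
      rw [Real.sqrt_lt' one_pos]
      simpa using hδ1
    have hss := Real.sq_sqrt hδ0.le
    rw [hncard {(1 - √δ) / 2, (1 + √δ) / 2}, Finset.card_pair (by linarith), mul_comm]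
    · intro b hb
      rw [Finset.mem_insert, Finset.mem_singleton] at hb
      rcases hb with rfl | rfl
      · constructor <;> linarith
      · constructor <;> linarith
    · intro x
      rw [Finset.mem_insert, Finset.mem_singleton]
      have hiff : T ^ 2 * (1 - 4 * (Int.fract x * (1 - Int.fract x)) * σ ^ 2) = r ^ 2 ↔
          (2 * Int.fract x - 1) ^ 2 = √δ ^ 2 := by
        rw [hss, ← mul_right_inj' (mul_ne_zero hT2 hσ2) (b := (2 * Int.fract x - 1) ^ 2), hδr]
        constructor
        · intro h
          linear_combination h
        · intro h
          linear_combination h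
      rw [hiff, sq_eq_sq_iff_eq_or_eq_neg]
      constructor
      · rintro (h | h)
        · right
          linarith
        · left
          linarith
      · rintro (h | h)
        · right
          linarith
        · left
          linarith
  · intro h
    refine hempty fun x hx => ?_
    have hf0 := Int.fract_nonneg x
    have hf1 : 0 ≤ 1 - Int.fract x := by linarith [Int.fract_lt_one x]
    rcases h with h | h
    · have h' : r ^ 2 < T ^ 2 * (1 - σ ^ 2) := by
        rw [← hcσ, ← mul_pow]
        gcongr
      have : 0 ≤ (2 * Int.fract x - 1) ^ 2 * (T ^ 2 * σ ^ 2) := by positivity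
      linarith
    · have h' : T ^ 2 < r ^ 2 := by gcongr
      have : 0 ≤ Int.fract x * (1 - Int.fract x) * (T ^ 2 * σ ^ 2) := by positivity
      linarith
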